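/- Let m, ℓ, r be natural numbers with 2 ≤ ℓ ≤ r ≤ m. Then W_{m,r}(2^{-ℓ}) ≤ Π_{j=ℓ}^{r} |A_{j-1, 17(j+2)}|. -/

import Mathlib

open Finset

abbrev Cube (m : ℕ) := Fin m → ZMod 2
abbrev BF (m : ℕ) := Cube m → ZMod 2

/-- Codewords of RM(m,r): functions computed by a polynomial of total degree ≤ r. -/
def RM (m r : ℕ) : Set (BF m) :=
  {f | ∃ p : MvPolynomial (Fin m) (ZMod 2), p.totalDegree ≤ r ∧
    ∀ x, MvPolynomial.eval x p = f x}

/-- Normalized weight of a Boolean function. -/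
noncomputable def wt {m : ℕ} (f : BF m) : ℝ :=
  ((univ.filter fun x => f x = 1).card : ℝ) / 2 ^ m

/-- Bias of a Boolean function. -/
noncomputable def bias {m : ℕ} (f : BF m) : ℝ :=
  (∑ x : Cube m, if f x = 0 then (1 : ℝ) else -1) / 2 ^ m

/-- Number of codewords of RM(m,r) of weight at most β. -/
noncomputable def W (m r : ℕ) (β : ℝ) : ℕ :=
  Set.ncard {f : BF m | f ∈ RM m r ∧ wt f ≤ β}

/-- binom(n, ≤ k) = ∑_{i=0}^k C(n,i). -/
def binomLe (n k : ℕ) : ℕ := ∑ i ∈ Finset.range (k + 1), n.choose i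

/-- Discrete derivative of f in direction y: Δ_y f(x) = f(x+y) + f(x). -/
def DD {m : ℕ} (y : Cube m) (f : BF m) : BF m := fun x => f (x + y) + f x

/-- Iterated discrete derivative Δ_Y f = Δ_{y₁}Δ_{y₂}···Δ_{y_k} f for a tuple
Y = (y₁,…,y_k) of directions. -/
def DDs {m k : ℕ} (Y : Fin k → Cube m) (f : BF m) : BF m :=
  (List.ofFn Y).foldr DD f

/-- Majority of a finite family of F₂ values: 1 if at least half of the values
equal 1, and 0 otherwise. -/
def Maj {ι : Type*} [Fintype ι] (v : ι → ZMod 2) : ZMod 2 :=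
  if Fintype.card ι ≤ 2 * (Finset.univ.filter fun i => v i = 1).card then 1 else 0

/-- The net A_{k,t}: all pointwise majorities of t order-k derivatives of a
polynomial of degree at most r. -/
def Anet (m r k t : ℕ) : Set (BF m) :=
  {g | ∃ f ∈ RM m r, ∃ Y : Fin t → Fin k → Cube m,
    g = fun x => Maj fun i => DDs (Y i) f x}


/-! ### Signs, biases and weights -/

/-- The nontrivial character of `ZMod 2` with real values. -/
def sgn (a : ZMod 2) : ℝ := if a = 0 then 1 else -1

lemma zmod_two_eq (a : ZMod 2) : a = 0 ∨ a = 1 := by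
  revert a; decide

lemma sgn_add (a b : ZMod 2) : sgn (a + b) = sgn a * sgn b := by
  have h : (1 + 1 : ZMod 2) = 0 := by decide
  rcases zmod_two_eq a with rfl | rfl <;> rcases zmod_two_eq b with rfl | rfl <;>
    simp [sgn, h]

lemma sgn_injective : Function.Injective sgn := by
  intro a b h
  rcases zmod_two_eq a with rfl | rfl <;> rcases zmod_two_eq b with rfl | rfl <;>
    simp [sgn] at h ⊢ <;> linarith

lemma sgn_le_one (a : ZMod 2) : sgn a ≤ 1 := by
  unfold sgn; split_ifs <;> norm_num

lemma sgn_mul_self (a : ZMod 2) : sgn a * sgn a = 1 := by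
  unfold sgn; split_ifs <;> norm_num

variable {m : ℕ}

lemma card_cube : Fintype.card (Cube m) = 2 ^ m := by
  simp [Cube, ZMod.card]

lemma bias_eq (f : BF m) : bias f = 1 - 2 * wt f := by
  have h : ∀ x, (if f x = 0 then (1 : ℝ) else -1) = 1 - 2 * (if f x = 1 then 1 else 0) := by
    intro x
    rcases zmod_two_eq (f x) with h | h <;> simp [h]
    norm_num
  have hc : (Fintype.card (Cube m) : ℝ) = 2 ^ m := by exact_mod_cast card_cube
  unfold bias wt
  simp_rw [h]
  rw [sum_sub_distrib, ← mul_sum, sum_boole, sum_const, card_univ, nsmul_eq_mul, hc]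
  field_simp

lemma sum_sgn_DD (f : BF m) (x : Cube m) :
    ∑ y, sgn (DD y f x) = 2 ^ m * bias f * sgn (f x) := by
  simp only [DD, sgn_add, ← sum_mul]
  have h := Equiv.sum_comp (Equiv.addLeft x) fun z => sgn (f z)
  simp only [Equiv.coe_addLeft] at h
  rw [h]
  unfold bias
  simp only [sgn]
  field_simp

lemma wt_add_le (f g : BF m) : wt (f + g) ≤ wt f + wt g := by
  unfold wt
  rw [← add_div]
  gcongr
  norm_cast
  refine (card_le_card ?_).trans (card_union_le _ _)
  intro x
  simp only [mem_filter, mem_univ, true_and, mem_union, Pi.add_apply]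
  rcases zmod_two_eq (f x) with h | h <;> rcases zmod_two_eq (g x) with h' | h' <;> simp [h, h']

lemma wt_translate (f : BF m) (y : Cube m) : wt (fun x => f (x + y)) = wt f := by
  unfold wt
  congr 2
  exact card_equiv (Equiv.addRight y) (by simp)

lemma wt_DD_le (f : BF m) (y : Cube m) : wt (DD y f) ≤ 2 * wt f := by
  have := wt_add_le (fun x => f (x + y)) f
  rw [wt_translate] at this
  exact this.trans (by linarith)

@[simp] lemma DDs_zero (Y : Fin 0 → Cube m) (f : BF m) : DDs Y f = f := by
  simp [DDs]

@[simp] lemma DDs_cons {k : ℕ} (y : Cube m) (Y : Fin k → Cube m) (f : BF m) :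
    DDs (Fin.cons y Y : Fin (k + 1) → Cube m) f = DD y (DDs Y f) := by
  simp [DDs, List.ofFn_succ]

lemma wt_DDs_le {k : ℕ} (Y : Fin k → Cube m) (f : BF m) : wt (DDs Y f) ≤ 2 ^ k * wt f := by
  induction k with
  | zero => simp
  | succ k ih =>
    obtain ⟨⟨y, Z⟩, rfl⟩ := (Fin.consEquiv fun _ => Cube m).surjective Y
    change wt (DDs (Fin.cons y Z) f) ≤ _
    rw [DDs_cons, pow_succ]
    linarith [wt_DD_le (DDs Z f) y, ih Z]

/-! ### Approximation of low-weight functions by derivatives -/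

/-- The sign of a low-weight function is a nonnegative combination, of small total mass, of the
signs of its derivatives. -/
lemma exists_weights (f : BF m) (w : ℝ) (hw : 0 ≤ w) (hf : wt f ≤ w) (k : ℕ)
    (hk : 2 ^ k * w < 1) :
    ∃ μ : (Fin k → Cube m) → ℝ, (∀ Y, 0 ≤ μ Y) ∧
      (∑ Y, μ Y) * ∏ i ∈ range k, (1 - 2 ^ (i + 1) * w) ≤ 1 ∧
      ∀ x, ∑ Y, μ Y * sgn (DDs Y f x) = sgn (f x) := by
  induction k with
  | zero => exact ⟨fun _ => 1, by simp, by simp, by simp⟩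
  | succ k ih =>
    have hpow : 2 ^ k * w ≤ 2 ^ (k + 1) * w := by gcongr <;> norm_num
    obtain ⟨μ, hμ, hsum, hrep⟩ := ih (hpow.trans_lt hk)
    have hpos : 0 < 1 - 2 ^ (k + 1) * w := by linarith
    have hb : ∀ Y : Fin k → Cube m, 1 - 2 ^ (k + 1) * w ≤ bias (DDs Y f) := by
      intro Y
      have h : (2 : ℝ) ^ k * wt f ≤ 2 ^ k * w := by gcongr
      rw [bias_eq, pow_succ]
      linarith [wt_DDs_le Y f]
    have hb0 : ∀ Y : Fin k → Cube m, 0 < bias (DDs Y f) := fun Y => hpos.trans_le (hb Y)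
    have hc : (Fintype.card (Cube m) : ℝ) = 2 ^ m := by exact_mod_cast card_cube
    have hcons : ∀ F : (Fin (k + 1) → Cube m) → ℝ,
        ∑ Z, F Z = ∑ Y : Fin k → Cube m, ∑ y, F (Fin.cons y Y) := by
      intro F
      rw [← Equiv.sum_comp (Fin.consEquiv fun _ => Cube m), Fintype.sum_prod_type_right]
      rfl
    refine ⟨fun Z => μ (Fin.tail Z) / (2 ^ m * bias (DDs (Fin.tail Z) f)), ?_, ?_, ?_⟩
    · exact fun Z => div_nonneg (hμ _) (mul_nonneg (by positivity) (hb0 _).le)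
    · rw [hcons, prod_range_succ]
      simp only [Fin.tail_cons, sum_const, card_univ, nsmul_eq_mul, hc]
      have hle : ∑ Y : Fin k → Cube m, 2 ^ m * (μ Y / (2 ^ m * bias (DDs Y f))) ≤
          (∑ Y, μ Y) / (1 - 2 ^ (k + 1) * w) := by
        rw [sum_div]
        refine sum_le_sum fun Y _ => ?_
        have : (2 : ℝ) ^ m * (μ Y / (2 ^ m * bias (DDs Y f))) = μ Y / bias (DDs Y f) := by
          have := (hb0 Y).ne'
          field_simp
        rw [this]
        exact div_le_div_of_nonneg_left (hμ Y) hpos (hb Y)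
      have hprod : 0 ≤ ∏ i ∈ range k, (1 - 2 ^ (i + 1) * w) := by
        refine prod_nonneg fun i hi => ?_
        have : (2 : ℝ) ^ (i + 1) * w ≤ 2 ^ (k + 1) * w := by
          have := (mem_range.1 hi).le
          gcongr
          norm_num
        linarith
      calc _ ≤ (∑ Y, μ Y) / (1 - 2 ^ (k + 1) * w) *
            ((∏ i ∈ range k, (1 - 2 ^ (i + 1) * w)) * (1 - 2 ^ (k + 1) * w)) :=
            mul_le_mul_of_nonneg_right hle (mul_nonneg hprod hpos.le)
        _ = (∑ Y, μ Y) * ∏ i ∈ range k, (1 - 2 ^ (i + 1) * w) := by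
            field_simp
        _ ≤ 1 := hsum
    · intro x
      rw [hcons, ← hrep x]
      refine sum_congr rfl fun Y _ => ?_
      simp only [Fin.tail_cons, DDs_cons, ← mul_sum, sum_sgn_DD]
      have := (hb0 Y).ne'
      field_simp

lemma prod_one_sub_half_pow_ge (k : ℕ) :
    (7 / 25 : ℝ) ≤ ∏ i ∈ range k, (1 - (1 / 2) ^ (i + 1)) := by
  have h01 : ∀ i : ℕ, (0 : ℝ) ≤ 1 - (1 / 2) ^ (i + 1) ∧ (1 : ℝ) - (1 / 2) ^ (i + 1) ≤ 1 := by
    intro i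
    have h₁ : (1 / 2 : ℝ) ^ (i + 1) ≤ 1 := pow_le_one₀ (by norm_num) (by norm_num)
    have h₂ : (0 : ℝ) ≤ (1 / 2 : ℝ) ^ (i + 1) := by positivity
    constructor <;> linarith
  have key : ∀ n : ℕ, (7 / 25 : ℝ) * (1 + 2 * (1 / 2) ^ (n + 5)) ≤
      ∏ i ∈ range (n + 5), (1 - (1 / 2 : ℝ) ^ (i + 1)) := by
    intro n
    induction n with
    | zero => norm_num [prod_range_succ]
    | succ n ih =>
      rw [show n + 1 + 5 = (n + 5) + 1 by ring, prod_range_succ]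
      refine le_trans ?_ (mul_le_mul_of_nonneg_right ih (h01 (n + 5)).1)
      have h₁ : (1 / 2 : ℝ) ^ (n + 5) ≤ 1 / 2 := by
        calc (1 / 2 : ℝ) ^ (n + 5) ≤ (1 / 2) ^ 1 :=
              pow_le_pow_of_le_one (by norm_num) (by norm_num) (by omega)
          _ = 1 / 2 := by norm_num
      have h₂ : (0 : ℝ) ≤ (1 / 2 : ℝ) ^ (n + 5) := by positivity
      rw [pow_succ (1 / 2 : ℝ) (n + 5)]
      nlinarith
  have hk : ∏ i ∈ range (k + 5), (1 - (1 / 2 : ℝ) ^ (i + 1)) ≤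
      ∏ i ∈ range k, (1 - (1 / 2 : ℝ) ^ (i + 1)) := by
    rw [prod_range_add]
    refine mul_le_of_le_one_right (prod_nonneg fun i _ => (h01 i).1) ?_
    exact prod_le_one (fun i _ => (h01 _).1) fun i _ => (h01 _).2
  have h₂ : (0 : ℝ) ≤ (1 / 2 : ℝ) ^ (k + 5) := by positivity
  linarith [key k]

/-- A probability distribution on directions under which every derivative is correlated with a
low-weight function at every point. -/
lemma exists_distribution (f : BF m) (k : ℕ) (hf : wt f ≤ (1 / 2) ^ (k + 1)) :
    ∃ μ : (Fin k → Cube m) → ℝ, (∀ Y, 0 ≤ μ Y) ∧ ∑ Y, μ Y = 1 ∧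
      ∀ x, 7 / 25 ≤ ∑ Y, μ Y * (sgn (DDs Y f x) * sgn (f x)) := by
  have hk : (2 : ℝ) ^ k * (1 / 2) ^ (k + 1) = 1 / 2 := by
    rw [pow_succ, ← mul_assoc, ← mul_pow]
    norm_num
  obtain ⟨μ, hμ, hsum, hrep⟩ := exists_weights f _ (by positivity) hf k (by rw [hk]; norm_num)
  have hprod : ∏ i ∈ range k, (1 - 2 ^ (i + 1) * (1 / 2 : ℝ) ^ (k + 1)) =
      ∏ i ∈ range k, (1 - (1 / 2 : ℝ) ^ (i + 1)) := by
    rw [← prod_range_reflect]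
    refine prod_congr rfl fun i hi => ?_
    have hi' := mem_range.1 hi
    have : k + 1 = (k - 1 - i + 1) + (i + 1) := by omega
    rw [this, pow_add (1 / 2 : ℝ), ← mul_assoc, ← mul_pow]
    norm_num
  rw [hprod] at hsum
  set M := ∑ Y, μ Y with hM
  have hone : ∀ x, ∑ Y, μ Y * (sgn (DDs Y f x) * sgn (f x)) = 1 := by
    intro x
    simp only [← mul_assoc, ← sum_mul]
    rw [hrep, sgn_mul_self]
  have hM1 : 1 ≤ M := by
    rw [← hone 0, hM]
    refine sum_le_sum fun Y _ => mul_le_of_le_one_right (hμ Y) ?_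
    rw [← sgn_add]
    exact sgn_le_one _
  have hM0 : 0 < M := by linarith
  refine ⟨fun Y => μ Y / M, fun Y => div_nonneg (hμ Y) hM0.le, ?_, fun x => ?_⟩
  · rw [← sum_div, ← hM, div_self hM0.ne']
  · simp only [div_mul_eq_mul_div]
    rw [← sum_div, hone, le_div_iff₀ hM0]
    nlinarith [prod_one_sub_half_pow_ge k]

/-- If the majority is wrong, then at least half of the votes are wrong. -/
lemma one_le_prod_of_Maj_ne {t : ℕ} (v : Fin t → ZMod 2) (b : ZMod 2) (h : Maj v ≠ b) :
    (1 : ℝ) ≤ ∏ i, if v i = b then 3 / 4 else 4 / 3 := by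
  rw [prod_ite, prod_const, prod_const]
  have hcard : #{i | v i = b} ≤ #{i | ¬ v i = b} := by
    have htot := card_filter_add_card_filter_not (s := (univ : Finset (Fin t))) fun i => v i = b
    simp only [card_univ, Fintype.card_fin] at htot
    unfold Maj at h
    rcases zmod_two_eq b with rfl | rfl
    · have he : #{i | ¬ v i = 0} = #{i | v i = 1} := by
        congr 1
        ext i
        rcases zmod_two_eq (v i) with h | h <;> simp [h]
      split_ifs at h with hc
      · simp only [Fintype.card_fin] at hc
        omega
      · exact absurd rfl h
    · split_ifs at h with hc
      · exact absurd rfl h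
      · simp only [Fintype.card_fin] at hc
        omega
  obtain ⟨d, hd⟩ := Nat.exists_eq_add_of_le hcard
  rw [hd, pow_add, ← mul_assoc, ← mul_pow]
  norm_num
  exact one_le_pow₀ (by norm_num)

/-- Chernoff bound for the probability that the majority of `t` independent random derivatives is
wrong at a point. -/
lemma sum_Maj_ne_le (f : BF m) (k t : ℕ) (μ : (Fin k → Cube m) → ℝ) (hμ : ∀ Y, 0 ≤ μ Y)
    (hsum : ∑ Y, μ Y = 1) (x : Cube m)
    (hcor : 7 / 25 ≤ ∑ Y, μ Y * (sgn (DDs Y f x) * sgn (f x))) :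
    ∑ Y : Fin t → Fin k → Cube m, (∏ i, μ (Y i)) *
      (if (Maj fun i => DDs (Y i) f x) + f x = 1 then (1 : ℝ) else 0) ≤ (24 / 25) ^ t := by
  set c : (Fin k → Cube m) → ℝ := fun Y => μ Y * if DDs Y f x = f x then 3 / 4 else 4 / 3 with hc
  have hcost : ∑ Y, c Y ≤ 24 / 25 := by
    have he : ∀ Y, c Y = 25 / 24 * μ Y - 7 / 24 * (μ Y * (sgn (DDs Y f x) * sgn (f x))) := by
      intro Y
      rcases zmod_two_eq (DDs Y f x) with h | h <;> rcases zmod_two_eq (f x) with h' | h' <;>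
        simp [hc, h, h', sgn] <;> ring
    simp_rw [he]
    rw [sum_sub_distrib, ← mul_sum, ← mul_sum, hsum]
    linarith
  have hcost0 : 0 ≤ ∑ Y, c Y :=
    sum_nonneg fun Y _ => mul_nonneg (hμ Y) (by split_ifs <;> norm_num)
  refine le_trans ?_ (pow_le_pow_left₀ hcost0 hcost t)
  rw [Fintype.sum_pow]
  refine sum_le_sum fun Y _ => ?_
  rw [hc, prod_mul_distrib]
  refine mul_le_mul_of_nonneg_left ?_ (prod_nonneg fun i _ => hμ _)
  split_ifs with h
  · refine one_le_prod_of_Maj_ne (fun i => DDs (Y i) f x) (f x) fun h' => ?_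
    rw [h', CharTwo.add_self_eq_zero] at h
    exact zero_ne_one h
  · exact prod_nonneg fun i _ => by split_ifs <;> norm_num

/-- A function of weight at most `2 ^ -(k + 1)` is approximated by a majority of derivatives. -/
lemma exists_Maj_approx (f : BF m) (k t : ℕ) (hf : wt f ≤ (1 / 2) ^ (k + 1)) :
    ∃ Y : Fin t → Fin k → Cube m,
      wt ((fun x => Maj fun i => DDs (Y i) f x) + f) ≤ (24 / 25) ^ t := by
  obtain ⟨μ, hμ, hsum, hcor⟩ := exists_distribution f k hf
  by_contra! hcon
  have hc : (Fintype.card (Cube m) : ℝ) = 2 ^ m := by exact_mod_cast card_cube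
  have hmass : ∑ Y : Fin t → Fin k → Cube m, ∏ i, μ (Y i) = 1 := by
    rw [← Fintype.sum_pow, hsum, one_pow]
  have hupper : ∑ Y : Fin t → Fin k → Cube m, (∏ i, μ (Y i)) *
      wt ((fun x => Maj fun i => DDs (Y i) f x) + f) ≤ (24 / 25) ^ t := by
    have he : ∑ Y : Fin t → Fin k → Cube m, (∏ i, μ (Y i)) *
        wt ((fun x => Maj fun i => DDs (Y i) f x) + f) =
        (∑ x, ∑ Y : Fin t → Fin k → Cube m, (∏ i, μ (Y i)) *
          (if (Maj fun i => DDs (Y i) f x) + f x = 1 then (1 : ℝ) else 0)) / 2 ^ m := by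
      rw [sum_comm, sum_div]
      refine sum_congr rfl fun Y _ => ?_
      rw [← mul_sum, sum_boole, mul_div_assoc]
      rfl
    rw [he, div_le_iff₀ (by positivity), mul_comm, ← hc]
    refine (sum_le_sum fun x _ => sum_Maj_ne_le f k t μ hμ hsum x (hcor x)).trans ?_
    rw [sum_const, card_univ, nsmul_eq_mul]
  obtain ⟨Y, hY⟩ : ∃ Y : Fin t → Fin k → Cube m, ∏ i, μ (Y i) ≠ 0 := by
    by_contra! h
    simp [h] at hmass
  have hlower : ∑ Y : Fin t → Fin k → Cube m, (∏ i, μ (Y i)) * (24 / 25 : ℝ) ^ t <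
      ∑ Y : Fin t → Fin k → Cube m, (∏ i, μ (Y i)) *
        wt ((fun x => Maj fun i => DDs (Y i) f x) + f) := by
    refine sum_lt_sum (fun Z _ => ?_) ⟨Y, mem_univ _, ?_⟩
    · exact mul_le_mul_of_nonneg_left (hcon Z).le (prod_nonneg fun i _ => hμ _)
    · exact mul_lt_mul_of_pos_left (hcon Y) ((prod_nonneg fun i _ => hμ _).lt_of_ne' hY)
  rw [← sum_mul, hmass, one_mul] at hlower
  linarith

/-! ### Degree and derivatives -/

/-- All `n`-fold derivatives of `f` vanish. -/
def VanishingDerivs : ℕ → BF m → Prop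
  | 0, f => f = 0
  | n + 1, f => ∀ y, VanishingDerivs n (DD y f)

namespace VanishingDerivs

lemma zero (n : ℕ) : VanishingDerivs n (0 : BF m) := by
  induction n with
  | zero => rfl
  | succ n ih =>
    intro y
    have : DD y (0 : BF m) = 0 := by ext x; simp [DD]
    rwa [this]

lemma add {n : ℕ} {f g : BF m} (hf : VanishingDerivs n f) (hg : VanishingDerivs n g) :
    VanishingDerivs n (f + g) := by
  induction n generalizing f g with
  | zero => rw [show f = 0 from hf, show g = 0 from hg]; exact zero 0
  | succ n ih =>
    intro y
    have : DD y (f + g) = DD y f + DD y g := by ext x; simp only [DD, Pi.add_apply]; ring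
    rw [this]
    exact ih (hf y) (hg y)

lemma succ {n : ℕ} {f : BF m} (hf : VanishingDerivs n f) : VanishingDerivs (n + 1) f := by
  induction n generalizing f with
  | zero => rw [show f = 0 from hf]; exact zero 1
  | succ n ih => exact fun y => ih (hf y)

lemma mono {n k : ℕ} {f : BF m} (hf : VanishingDerivs n f) (h : n ≤ k) :
    VanishingDerivs k f := by
  induction h with
  | refl => exact hf
  | step _ ih => exact ih.succ

lemma const_mul {n : ℕ} {f : BF m} (hf : VanishingDerivs n f) (c : ZMod 2) :
    VanishingDerivs n fun x => c * f x := by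
  rcases zmod_two_eq c with rfl | rfl
  · simp only [zero_mul]
    exact zero n
  · simpa using hf

lemma translate {n : ℕ} {f : BF m} (hf : VanishingDerivs n f) (y : Cube m) :
    VanishingDerivs n fun x => f (x + y) := by
  have h : (fun x => f (x + y)) = DD y f + f := by
    ext x
    simp [DD, add_assoc, CharTwo.add_self_eq_zero]
  rw [h]
  exact add (hf.succ y) hf

lemma coord_mul {n : ℕ} {f : BF m} (hf : VanishingDerivs n f) (i : Fin m) :
    VanishingDerivs (n + 1) fun x => x i * f x := by
  induction n generalizing f with
  | zero =>
    rw [show f = 0 from hf]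
    simp only [Pi.zero_apply, mul_zero]
    exact zero 1
  | succ n ih =>
    intro y
    have h : DD y (fun x => x i * f x) =
        (fun x => x i * DD y f x) + fun x => y i * f (x + y) := by
      ext x
      simp only [DD, Pi.add_apply]
      ring
    rw [h]
    exact add (ih (hf y)) ((hf.translate y).const_mul (y i))

lemma coord_pow_mul {n : ℕ} {f : BF m} (hf : VanishingDerivs n f) (i : Fin m) (e : ℕ) :
    VanishingDerivs (n + e) fun x => x i ^ e * f x := by
  induction e with
  | zero => simpa using hf
  | succ e ih =>
    simp only [pow_succ', mul_assoc]
    exact ih.coord_mul i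

lemma prod_coord_pow (s : Finset (Fin m)) (d : Fin m → ℕ) :
    VanishingDerivs (1 + ∑ i ∈ s, d i) fun x => ∏ i ∈ s, x i ^ d i := by
  induction s using Finset.induction_on with
  | empty =>
    intro y
    ext x
    simp [DD, CharTwo.add_self_eq_zero]
  | insert i s hi ih =>
    simp only [prod_insert hi, sum_insert hi]
    rw [show 1 + (d i + ∑ j ∈ s, d j) = (1 + ∑ j ∈ s, d j) + d i by ring]
    exact ih.coord_pow_mul i (d i)

lemma sum {ι : Type*} {n : ℕ} (s : Finset ι) (F : ι → BF m)
    (hF : ∀ i ∈ s, VanishingDerivs n (F i)) : VanishingDerivs n (∑ i ∈ s, F i) :=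
  sum_induction F _ (fun _ _ => add) (zero n) hF

lemma of_mem_RM {r : ℕ} {f : BF m} (hf : f ∈ RM m r) : VanishingDerivs (r + 1) f := by
  obtain ⟨p, hp, hpf⟩ := hf
  have h : f = ∑ d ∈ p.support, fun x : Cube m => p.coeff d * ∏ i, x i ^ d i := by
    ext x
    rw [← hpf, MvPolynomial.eval_eq', Finset.sum_apply]
  rw [h]
  refine sum _ _ fun d hd => const_mul (mono (prod_coord_pow univ d) ?_) _
  have := (MvPolynomial.le_totalDegree hd).trans hp
  rw [Finsupp.sum_fintype _ _ fun _ => rfl] at this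
  omega

lemma DDs {n k : ℕ} {f : BF m} (hf : VanishingDerivs (n + k) f) (Y : Fin k → Cube m) :
    VanishingDerivs n (DDs Y f) := by
  induction k generalizing n with
  | zero => simpa using hf
  | succ k ih =>
    obtain ⟨⟨y, Z⟩, rfl⟩ := (Fin.consEquiv fun _ => Cube m).surjective Y
    change VanishingDerivs n (_root_.DDs (Fin.cons y Z) f)
    rw [DDs_cons]
    exact ih (n := n + 1) (by rwa [add_assoc, add_comm 1 k]) Z y

end VanishingDerivs

/-- A codeword of `RM(m,r)` whose weight is below the minimum distance vanishes. -/
lemma eq_zero_of_mem_RM {r : ℕ} {f : BF m} (hf : f ∈ RM m r) (hw : wt f ≤ (1 / 2) ^ (r + 1)) :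
    f = 0 := by
  have hk : (2 : ℝ) ^ r * (1 / 2) ^ (r + 1) = 1 / 2 := by
    rw [pow_succ, ← mul_assoc, ← mul_pow]
    norm_num
  obtain ⟨μ, -, -, hrep⟩ := exists_weights f _ (by positivity) hw r (by rw [hk]; norm_num)
  have hconst : ∀ x, f x = f 0 := by
    intro x
    refine sgn_injective ?_
    rw [← hrep x, ← hrep 0]
    refine sum_congr rfl fun Y _ => ?_
    have h := (VanishingDerivs.of_mem_RM hf).mono (k := 1 + r) (by omega) |>.DDs Y
    have h₀ := congrFun (show DD x (DDs Y f) = 0 from h x) 0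
    simp only [DD, zero_add, Pi.zero_apply] at h₀
    rw [CharTwo.add_eq_zero.1 h₀]
  rcases zmod_two_eq (f 0) with h | h
  · ext x
    rw [hconst, h, Pi.zero_apply]
  · have hwt : wt f = 1 := by
      have hc : (Fintype.card (Cube m) : ℝ) = 2 ^ m := by exact_mod_cast card_cube
      unfold wt
      simp only [hconst, h, filter_true, card_univ, hc]
      exact div_self (by positivity)
    have : (1 / 2 : ℝ) ^ (r + 1) < 1 := pow_lt_one₀ (by norm_num) (by norm_num) (by omega)
    linarith

lemma add_mem_RM {r : ℕ} {f g : BF m} (hf : f ∈ RM m r) (hg : g ∈ RM m r) : f + g ∈ RM m r := by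
  obtain ⟨p, hp, hpf⟩ := hf
  obtain ⟨q, hq, hqg⟩ := hg
  exact ⟨p + q, (MvPolynomial.totalDegree_add p q).trans (max_le hp hq), fun x => by
    rw [map_add, hpf, hqg, Pi.add_apply]⟩

/-! ### Counting -/

lemma W_min_le_one (m r : ℕ) : W m r ((1 / 2) ^ (r + 1)) ≤ 1 := by
  unfold W
  rw [Set.ncard_le_one (Set.toFinite _)]
  rintro f ⟨hf, hfw⟩ g ⟨hg, hgw⟩
  rw [eq_zero_of_mem_RM hf hfw, eq_zero_of_mem_RM hg hgw]

lemma W_le_Anet_mul_W (m r k : ℕ) :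
    W m r ((1 / 2) ^ (k + 1)) ≤
      (Anet m r k (17 * (k + 3))).ncard * W m r ((1 / 2) ^ (k + 2)) := by
  classical
  have happrox : ∀ f : BF m, ∃ g : BF m, f ∈ RM m r ∧ wt f ≤ (1 / 2) ^ (k + 1) →
      g ∈ Anet m r k (17 * (k + 3)) ∧ wt (g + f) ≤ (1 / 2) ^ (k + 3) := by
    intro f
    by_cases hf : f ∈ RM m r ∧ wt f ≤ (1 / 2) ^ (k + 1)
    · obtain ⟨Y, hY⟩ := exists_Maj_approx f k (17 * (k + 3)) hf.2
      refine ⟨_, fun _ => ⟨⟨f, hf.1, Y, rfl⟩, hY.trans ?_⟩⟩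
      rw [pow_mul]
      exact pow_le_pow_left₀ (by positivity) (by norm_num) _
    · exact ⟨0, fun h => absurd h hf⟩
  choose φ hφ using happrox
  unfold W
  rw [Set.ncard_eq_toFinset_card', Set.ncard_eq_toFinset_card', Set.ncard_eq_toFinset_card',
    mul_comm]
  refine card_le_mul_card_image_of_maps_to (f := φ) (fun f hf => ?_) _ fun g _ => ?_
  · simp only [Set.mem_toFinset] at hf ⊢
    exact (hφ f hf).1
  · rcases (filter (fun f => φ f = g) _).eq_empty_or_nonempty with h | ⟨f₀, hf₀⟩
    · rw [h]
      exact Nat.zero_le _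
    · simp only [mem_filter, Set.mem_toFinset, Set.mem_ofPred_eq] at hf₀
      refine card_le_card_of_injOn (fun f => f + f₀) (fun f hf => ?_)
        (fun _ _ _ _ h => add_right_cancel h)
      simp only [coe_filter, Set.mem_toFinset, Set.mem_ofPred_eq, Set.coe_toFinset] at hf ⊢
      refine ⟨add_mem_RM hf.1.1 hf₀.1.1, ?_⟩
      have hsum : f + f₀ = (φ f + f) + (φ f₀ + f₀) := by
        rw [hf.2, hf₀.2]
        ext x
        simp only [Pi.add_apply]
        linear_combination -CharTwo.add_self_eq_zero (g x)
      rw [hsum]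
      have h₁ := (hφ f hf.1).2
      have h₂ := (hφ f₀ hf₀.1).2
      have h₃ : (1 / 2 : ℝ) ^ (k + 3) = (1 / 2) ^ (k + 2) * (1 / 2) := pow_succ _ _
      linarith [wt_add_le (φ f + f) (φ f₀ + f₀)]

lemma W_le_prod_Anet (m r n ℓ : ℕ) (hn : ℓ + n = r + 1) (hℓ : 1 ≤ ℓ) :
    W m r ((1 / 2) ^ ℓ) ≤ ∏ j ∈ Icc ℓ r, (Anet m r (j - 1) (17 * (j + 2))).ncard := by
  induction n generalizing ℓ with
  | zero =>
    obtain rfl : ℓ = r + 1 := by omega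
    simpa using W_min_le_one m r
  | succ n ih =>
    obtain ⟨k, rfl⟩ : ∃ k, ℓ = k + 1 := ⟨ℓ - 1, by omega⟩
    rw [← mul_prod_Ioc_eq_prod_Icc (by omega), ← Icc_succ_left_eq_Ioc]
    exact (W_le_Anet_mul_W m r k).trans (Nat.mul_le_mul_left _ (ih (k + 2) (by omega) (by omega)))

/-- W_{m,r}(2^{-ℓ}) ≤ ∏_{j=ℓ}^{r} |A_{j-1, 17(j+2)}|
(Corollary `recursion for weight 2`). -/
theorem weight_distribution_recursion (m r ℓ : ℕ) (hℓ : 2 ≤ ℓ) (hℓr : ℓ ≤ r)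
    (hrm : r ≤ m) :
    W m r ((2 : ℝ) ^ (-(ℓ : ℤ))) ≤
      ∏ j ∈ Finset.Icc ℓ r, (Anet m r (j - 1) (17 * (j + 2))).ncard := by
  have h : (2 : ℝ) ^ (-(ℓ : ℤ)) = (1 / 2) ^ ℓ := by
    rw [zpow_neg, zpow_natCast, one_div, inv_pow]
  rw [h]
  exact W_le_prod_Anet m r (r + 1 - ℓ) ℓ (by omega) (by omega)
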